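/- Let G be a finite group with α(G) = α(Z(G)). Then G/Z(G) is an elementary abelian 2-group, i.e. every nontrivial element of G/Z(G) has order 2 and G/Z(G) is abelian. -/

import Mathlib

/-- `α(G) = |C(G)| / |G|`, where `C(G)` is the set of cyclic subgroups of `G`. -/
noncomputable def alpha (G : Type*) [Group G] : ℚ :=
  (Nat.card {H : Subgroup G // IsCyclic H} : ℚ) / (Nat.card G : ℚ)

/-- The generators of a cyclic subgroup `H` of a finite group are `φ(|H|)` in number. -/
theorem Subgroup.card_filter_zpowers_eq {G : Type*} [Group G] [Fintype G]
    (H : Subgroup G) [IsCyclic H] [DecidablePred fun x : G => Subgroup.zpowers x = H] :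
    (Finset.univ.filter fun x : G => Subgroup.zpowers x = H).card = (Nat.card H).totient := by
  classical
  have := Fintype.ofFinite H
  rw [Nat.card_eq_fintype_card, ← IsCyclic.card_orderOf_eq_totient (α := H) dvd_rfl]
  symm
  refine Finset.card_bij (fun (x : H) _ => (x : G)) ?_ ?_ ?_
  · intro x hx
    simp only [Finset.mem_filter, Finset.mem_univ, true_and] at hx ⊢
    apply Subgroup.eq_of_le_of_card_ge
    · simp
    · rw [Nat.card_zpowers, Subgroup.orderOf_coe, hx, Nat.card_eq_fintype_card]
  · intro a _ b _ hab
    exact Subtype.ext hab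
  · intro x hx
    simp only [Finset.mem_filter, Finset.mem_univ, true_and] at hx
    refine ⟨⟨x, hx ▸ Subgroup.mem_zpowers x⟩, ?_, rfl⟩
    simp only [Finset.mem_filter, Finset.mem_univ, true_and]
    rw [Subgroup.orderOf_mk, ← Nat.card_zpowers, hx, Nat.card_eq_fintype_card]

/-- Counting the cyclic subgroups of a finite group by their generators. -/
theorem card_isCyclic_eq_sum_inv_totient (G : Type*) [Group G] [Fintype G] :
    (Nat.card {H : Subgroup G // IsCyclic H} : ℚ) =
      ∑ x : G, ((orderOf x).totient : ℚ)⁻¹ := by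
  classical
  have := Fintype.ofFinite {H : Subgroup G // IsCyclic H}
  let gen : G → {H : Subgroup G // IsCyclic H} := fun x => ⟨Subgroup.zpowers x, inferInstance⟩
  rw [← Finset.sum_fiberwise Finset.univ gen, Nat.card_eq_fintype_card, Fintype.card_eq_sum_ones,
    Nat.cast_sum]
  refine Finset.sum_congr rfl fun H _ => ?_
  have := H.2
  have hcard := Subgroup.card_filter_zpowers_eq H.1
  have hfilter : (Finset.univ.filter fun x => gen x = H) =
      Finset.univ.filter fun x : G => Subgroup.zpowers x = H.1 := by
    ext x
    simp [gen, Subtype.ext_iff]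
  rw [hfilter, Finset.sum_congr rfl (g := fun _ => ((Nat.card H.1).totient : ℚ)⁻¹),
    Finset.sum_const, hcard, nsmul_eq_mul, mul_inv_cancel₀, Nat.cast_one]
  · exact_mod_cast (Nat.totient_pos.2 Nat.card_pos).ne'
  · intro x hx
    rw [Finset.mem_filter] at hx
    rw [← hx.2, Nat.card_zpowers]

/-- If `z` commutes with `y` and `orderOf z ∤ orderOf (y * z)`, then multiplying `y` by a suitable
power of `z` lowers its order. -/
theorem Commute.exists_orderOf_mul_zpow_lt {G : Type*} [Group G] [Finite G] {y z : G}
    (hyz : Commute y z) (h : ¬ orderOf z ∣ orderOf (y * z)) :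
    ∃ k : ℤ, orderOf (y * z ^ k) < orderOf y := by
  rw [Nat.dvd_iff_prime_pow_dvd_dvd] at h
  push Not at h
  obtain ⟨p, c, hp, hcz, hcn⟩ := h
  obtain ⟨b, m, hpm, hn⟩ :=
    Nat.exists_eq_pow_mul_and_not_dvd (orderOf_pos (y * z)).ne' p hp.ne_one
  have hbc : b < c := by
    by_contra! hcb
    exact hcn (hn ▸ (pow_dvd_pow p hcb).mul_right m)
  have hcy : p ^ c ∣ orderOf y := by
    have hcomm : Commute y⁻¹ (y * z) := ((Commute.refl y).mul_right hyz).inv_left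
    have hlcm := hcz.trans (by simpa using hcomm.orderOf_mul_dvd_lcm)
    rw [hp.pow_dvd_iff_le_factorization (Nat.lcm_ne_zero (orderOf_pos _).ne' (orderOf_pos _).ne'),
      Nat.factorization_lcm (orderOf_pos y).ne' (orderOf_pos _).ne', Finsupp.sup_apply,
      le_sup_iff, ← hp.pow_dvd_iff_le_factorization (orderOf_pos _).ne',
      ← hp.pow_dvd_iff_le_factorization (orderOf_pos _).ne'] at hlcm
    exact hlcm.resolve_right hcn
  obtain ⟨N, hN⟩ : p ∣ orderOf y := (dvd_pow_self p (by omega)).trans hcy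
  have hbN : p ^ b ∣ N := by
    have : p * p ^ b ∣ p * N := hN ▸ (pow_succ' p b ▸ pow_dvd_pow p hbc).trans hcy
    exact Nat.dvd_of_mul_dvd_mul_left hp.pos this
  have hNpos : 0 < N := Nat.pos_of_mul_pos_left (hN ▸ orderOf_pos y)
  obtain ⟨s, t, hst⟩ := Nat.isCoprime_iff_coprime.2 ((hp.coprime_iff_not_dvd).2 hpm)
  refine ⟨t * m, lt_of_le_of_lt (Nat.le_of_dvd hNpos (orderOf_dvd_of_pow_eq_one ?_)) ?_⟩
  · have hsplit : y * z ^ (t * m) = y ^ (s * p) * (y * z) ^ (t * m) := by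
      rw [hyz.mul_zpow, ← mul_assoc, ← zpow_add, hst, zpow_one]
    have hcomm : Commute (y ^ (s * p)) ((y * z) ^ (t * m)) :=
      (((Commute.refl y).mul_right hyz).zpow_left _).zpow_right _
    rw [hsplit, hcomm.mul_pow, ← zpow_natCast, ← zpow_natCast, ← zpow_mul, ← zpow_mul,
      orderOf_dvd_iff_zpow_eq_one.1, orderOf_dvd_iff_zpow_eq_one.1, one_mul]
    · rw [hn]
      obtain ⟨d, rfl⟩ := hbN
      exact ⟨t * d, by push_cast; ring⟩
    · rw [hN]
      exact ⟨s, by push_cast; ring⟩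
  · rw [hN]
    exact lt_mul_left hNpos hp.one_lt

/-- Every coset of a central subgroup `Z` has a representative `y` such that
`orderOf z ∣ orderOf (y * z)` for all `z ∈ Z`. -/
theorem Subgroup.exists_orderOf_dvd_orderOf_mul {G : Type*} [Group G] [Finite G]
    {Z : Subgroup G} (hZ : Z ≤ Subgroup.center G) (g : G) :
    ∃ w : Z, ∀ z : Z, orderOf z ∣ orderOf (g * w * z) := by
  obtain ⟨w, hw⟩ := Finite.exists_min fun w : Z => orderOf (g * w)
  refine ⟨w, fun z => ?_⟩
  by_contra hz
  rw [← Subgroup.orderOf_coe] at hz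
  obtain ⟨k, hk⟩ := Commute.exists_orderOf_mul_zpow_lt
    (Subgroup.mem_center_iff.1 (hZ z.2) (g * w)) hz
  have := hw (w * z ^ k)
  push_cast at this
  rw [← mul_assoc] at this
  omega

theorem Nat.inv_totient_le_of_dvd {a b : ℕ} (hb : 0 < b) (h : a ∣ b) :
    ((b.totient : ℚ))⁻¹ ≤ ((a.totient : ℚ))⁻¹ := by
  have ha : 0 < a.totient := Nat.totient_pos.2 (Nat.pos_of_dvd_of_pos h hb)
  have hle : a.totient ≤ b.totient :=
    Nat.le_of_dvd (Nat.totient_pos.2 hb) (Nat.totient_dvd_of_dvd h)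
  gcongr

/-- If `α(G) = α(Z(G))`, every coset of the center contains an element squaring to `1`. -/
theorem exists_mem_center_mul_sq_eq_one {G : Type*} [Group G] [Finite G]
    (h : alpha G = alpha (Subgroup.center G)) (g : G) :
    ∃ w : Subgroup.center G, (g * w) ^ 2 = 1 := by
  have := Fintype.ofFinite G
  have := Fintype.ofFinite (Subgroup.center G)
  let f : G → ℚ := fun x => ((orderOf x).totient : ℚ)⁻¹
  let c : ℚ := ∑ z : Subgroup.center G, ((orderOf z).totient : ℚ)⁻¹
  have hshift (x : G) (w : Subgroup.center G) :
      ∑ z : Subgroup.center G, f (x * w * z) = ∑ z : Subgroup.center G, f (x * z) :=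
    Fintype.sum_equiv (Equiv.mulLeft w) _ _ fun z => by simp [mul_assoc]
  have hle (x : G) : ∑ z : Subgroup.center G, f (x * z) ≤ c := by
    obtain ⟨w, hw⟩ := Subgroup.exists_orderOf_dvd_orderOf_mul le_rfl x
    rw [← hshift x w]
    exact Finset.sum_le_sum fun z _ => Nat.inv_totient_le_of_dvd (orderOf_pos _) (hw z)
  have htotal : ∑ x : G, ∑ z : Subgroup.center G, f (x * z) = ∑ _x : G, c := by
    have hright (z : Subgroup.center G) : ∑ x : G, f (x * z) = ∑ x : G, f x :=
      Fintype.sum_equiv (Equiv.mulRight (z : G)) _ _ fun x => rfl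
    rw [Finset.sum_comm, Finset.sum_congr rfl fun z _ => hright z]
    have hG : (Nat.card G : ℚ) ≠ 0 := by exact_mod_cast Nat.card_pos.ne'
    have hZ : (Nat.card (Subgroup.center G) : ℚ) ≠ 0 := by exact_mod_cast Nat.card_pos.ne'
    rw [alpha, alpha, card_isCyclic_eq_sum_inv_totient, card_isCyclic_eq_sum_inv_totient,
      div_eq_div_iff hG hZ] at h
    simp only [Finset.sum_const, Finset.card_univ, nsmul_eq_mul, ← Nat.card_eq_fintype_card]
    linarith
  have heq := (Finset.sum_eq_sum_iff_of_le fun x _ => hle x).1 htotal g (Finset.mem_univ g)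
  obtain ⟨w, hw⟩ := Subgroup.exists_orderOf_dvd_orderOf_mul le_rfl g
  rw [← hshift g w] at heq
  have hone := (Finset.sum_eq_sum_iff_of_le fun z _ =>
    Nat.inv_totient_le_of_dvd (orderOf_pos _) (hw z)).1 heq 1 (Finset.mem_univ 1)
  refine ⟨w, orderOf_dvd_iff_pow_eq_one.1 ?_⟩
  simp only [OneMemClass.coe_one, mul_one, orderOf_one, Nat.totient_one, Nat.cast_one, inv_one,
    inv_eq_one, Nat.cast_eq_one, Nat.totient_eq_one_iff] at hone
  rcases hone with hone | hone <;> simp [hone]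

/-- If `α(G) = α(Z(G))`, then `G/Z(G)` is an elementary abelian 2-group: every
nontrivial element has order 2 and the quotient is abelian. -/
theorem quotient_center_elementary_abelian (G : Type*) [Group G] [Finite G]
    (h : alpha G = alpha (Subgroup.center G)) :
    (∀ g : G ⧸ Subgroup.center G, g ≠ 1 → orderOf g = 2) ∧
      ∀ a b : G ⧸ Subgroup.center G, a * b = b * a := by
  have hsq (g : G ⧸ Subgroup.center G) : g ^ 2 = 1 := by
    obtain ⟨x, rfl⟩ := QuotientGroup.mk_surjective g
    obtain ⟨w, hw⟩ := exists_mem_center_mul_sq_eq_one h x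
    rw [← QuotientGroup.mk_mul_of_mem x w.2, ← QuotientGroup.mk_pow, hw, QuotientGroup.mk_one]
  exact ⟨fun g hg => orderOf_eq_prime (hsq g) hg,
    fun a b => (Commute.of_orderOf_dvd_two fun g => orderOf_dvd_of_pow_eq_one (hsq g)) a b⟩
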